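/- arXiv:hep-th/9607132 — 3 statements merged into one kernel-verified Lean document; each statement's English description precedes it below -/
import Mathlib

section
/- Let R be a commutative ring and A an R-algebra graded by the additive group (ℤ/2)^N, i.e. A = ⊕_{γ∈(ℤ/2)^N} A_γ with A_γ · A_δ ⊆ A_{γ+δ} and 1 ∈ A_0. Define a new product on homogeneous elements by a ·ₛ b := (−1)^{Σ_{i>j} γ_i δ_j} · (ab) for a ∈ A_γ, b ∈ A_δ (the components γ_i, δ_j ∈ {0,1} regarded as integers), extended bi-additively. Then the product ·ₛ is associative and has the same unit 1, so that (A, +, ·ₛ) is again an R-algebra. -/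
/-- The exponent `∑_{i>j} γ_i δ_j` of the sign twisting the product of homogeneous elements. -/
abbrev signExponent {N : ℕ} (γ δ : Fin N → ZMod 2) : ℕ :=
  ∑ i : Fin N, ∑ j : Fin N, if j < i then (γ i).val * (δ j).val else 0

lemma natCast_signExponent_add_left {N : ℕ} (γ δ ε : Fin N → ZMod 2) :
    (signExponent (γ + δ) ε : ZMod 2) = signExponent γ ε + signExponent δ ε := by
  simp [Finset.sum_add_distrib, ite_add_zero, add_mul]

lemma natCast_signExponent_add_right {N : ℕ} (γ δ ε : Fin N → ZMod 2) :
    (signExponent γ (δ + ε) : ZMod 2) = signExponent γ δ + signExponent γ ε := by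
  simp [Finset.sum_add_distrib, ite_add_zero, mul_add]

lemma neg_one_pow_signExponent_cocycle (A : Type*) [Ring A] {N : ℕ}
    (γ δ ε : Fin N → ZMod 2) :
    (-1 : A) ^ (signExponent γ δ + signExponent (γ + δ) ε) =
      (-1 : A) ^ (signExponent δ ε + signExponent γ (δ + ε)) := by
  apply neg_one_pow_congr
  rw [← ZMod.natCast_eq_zero_iff_even, ← ZMod.natCast_eq_zero_iff_even]
  rw [Nat.cast_add, Nat.cast_add, natCast_signExponent_add_left, natCast_signExponent_add_right]
  ring_nf

lemma LinearMap.map_neg_one_pow_mul {R A B : Type*} [CommRing R] [Ring A] [Ring B]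
    [Module R A] [Module R B] (f : A →ₗ[R] B) (n : ℕ) (x : A) :
    f ((-1) ^ n * x) = (-1) ^ n * f x := by
  rcases Nat.even_or_odd n with h | h <;> simp [h.neg_one_pow]

lemma Submodule.neg_one_pow_mul_mem {R A : Type*} [CommRing R] [Ring A] [Module R A]
    (p : Submodule R A) (n : ℕ) {x : A} (hx : x ∈ p) : (-1) ^ n * x ∈ p := by
  rcases Nat.even_or_odd n with h | h <;> simpa [h.neg_one_pow] using hx

/-- Let `A` be an `R`-algebra graded by `(ℤ/2)^N`. If `mul'` is the
`R`-bilinear product determined on homogeneous elements `a ∈ 𝒜 γ`, `b ∈ 𝒜 δ` by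
`a ·ₛ b = (−1)^{∑_{i>j} γ_i δ_j} (a b)`, then `·ₛ` is associative and has unit `1`,
so `(A, +, ·ₛ)` is again an `R`-algebra. -/
theorem statement0 (R A : Type*) [CommRing R] [Ring A] [Algebra R A] (N : ℕ)
    (𝒜 : (Fin N → ZMod 2) → Submodule R A) [GradedAlgebra 𝒜]
    (mul' : A →ₗ[R] A →ₗ[R] A)
    (hmul : ∀ (γ δ : Fin N → ZMod 2) (a b : A), a ∈ 𝒜 γ → b ∈ 𝒜 δ →
      mul' a b =
        (-1 : A) ^ (∑ i : Fin N, ∑ j : Fin N,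
          if j < i then (γ i).val * (δ j).val else 0) * (a * b)) :
    (∀ a b c : A, mul' (mul' a b) c = mul' a (mul' b c)) ∧
    (∀ a : A, mul' 1 a = a) ∧ (∀ a : A, mul' a 1 = a) := by
  refine ⟨fun a b c => ?_, fun a => ?_, fun a => ?_⟩
  · induction a using DirectSum.Decomposition.inductionOn 𝒜 with
    | zero => simp
    | add a a' ha ha' => simp [ha, ha']
    | @homogeneous γ a =>
    induction b using DirectSum.Decomposition.inductionOn 𝒜 with
    | zero => simp
    | add b b' hb hb' => simp [hb, hb']
    | @homogeneous δ b =>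
    induction c using DirectSum.Decomposition.inductionOn 𝒜 with
    | zero => simp
    | add c c' hc hc' => simp [hc, hc']
    | @homogeneous ε c =>
    obtain ⟨a, ha⟩ := a
    obtain ⟨b, hb⟩ := b
    obtain ⟨c, hc⟩ := c
    have hab := SetLike.mul_mem_graded ha hb
    have hbc := SetLike.mul_mem_graded hb hc
    have key := neg_one_pow_signExponent_cocycle A γ δ ε
    rw [hmul γ δ a b ha hb, hmul δ ε b c hb hc,
      hmul (γ + δ) ε _ c (Submodule.neg_one_pow_mul_mem _ _ hab) hc,
      hmul γ (δ + ε) a _ ha (Submodule.neg_one_pow_mul_mem _ _ hbc)]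
    change (-1) ^ signExponent (γ + δ) ε * ((-1) ^ signExponent γ δ * (a * b) * c) =
      (-1) ^ signExponent γ (δ + ε) * (a * ((-1) ^ signExponent δ ε * (b * c)))
    have hcomm : a * ((-1) ^ signExponent δ ε * (b * c)) =
        (-1) ^ signExponent δ ε * (a * (b * c)) :=
      (LinearMap.mulLeft R a).map_neg_one_pow_mul _ _
    rw [hcomm, mul_assoc ((-1) ^ signExponent γ δ), ← mul_assoc, ← pow_add, add_comm, key,
      add_comm, pow_add, mul_assoc, mul_assoc a]
  · induction a using DirectSum.Decomposition.inductionOn 𝒜 with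
    | zero => simp
    | add a a' ha ha' => simp [ha, ha']
    | @homogeneous γ a => simp [hmul 0 γ 1 a SetLike.GradedOne.one_mem a.2]
  · induction a using DirectSum.Decomposition.inductionOn 𝒜 with
    | zero => simp
    | add a a' ha ha' => simp [ha, ha']
    | @homogeneous γ a => simp [hmul γ 0 a 1 a.2 SetLike.GradedOne.one_mem]
end

section
/- Let R be a commutative ring and A an R-algebra graded by (ℤ/2)^N which is (ℤ/2)^N-commutative, i.e. ba = (−1)^{Σ_i γ_i δ_i} ab for all homogeneous a ∈ A_γ, b ∈ A_δ. Equip A with the twisted product a ·ₛ b := (−1)^{Σ_{i>j} γ_i δ_j} ab on homogeneous elements, extended bi-additively. Then A with the product ·ₛ is ℤ/2-commutative with respect to the total degree: for a ∈ A_γ, b ∈ A_δ one has b ·ₛ a = (−1)^{(Σ_i γ_i)(Σ_i δ_i)} a ·ₛ b. -/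
/-- The product of two sums over a linear order splits into its diagonal part and its two
strictly triangular parts. -/
theorem Finset.sum_mul_sum_eq_diag_add_triangular {ι S : Type*} [Fintype ι] [LinearOrder ι]
    [CommSemiring S] (f g : ι → S) :
    (∑ i, f i) * ∑ i, g i = ∑ i, f i * g i + (∑ i, ∑ j, if j < i then f i * g j else 0) +
      ∑ i, ∑ j, if j < i then g i * f j else 0 := by
  have hdiag : ∑ i, f i * g i = ∑ i, ∑ j, if i = j then f i * g j else 0 := by simp
  have hupper : (∑ i, ∑ j, if j < i then g i * f j else 0) =
      ∑ i, ∑ j, if i < j then f i * g j else 0 := by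
    rw [Finset.sum_comm]
    simp only [mul_comm]
  rw [Finset.sum_mul_sum, hdiag, hupper]
  simp only [← Finset.sum_add_distrib]
  refine Finset.sum_congr rfl fun i _ => Finset.sum_congr rfl fun j _ => ?_
  rcases lt_trichotomy i j with h | h | h
  · simp [h, h.ne, h.not_gt]
  · simp [h]
  · simp [h, h.ne', h.not_gt]

/-- Let `A` be an `R`-algebra graded by `(ℤ/2)^N` which is
`(ℤ/2)^N`-commutative: `b a = (−1)^{∑_i γ_i δ_i} (a b)` for homogeneous `a ∈ 𝒜 γ`,
`b ∈ 𝒜 δ`.  Equip `A` with the twisted product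
`a ·ₛ b = (−1)^{∑_{i>j} γ_i δ_j} (a b)` (extended bi-additively).  Then `A` with `·ₛ`
is `ℤ/2`-commutative for the total degree:
`b ·ₛ a = (−1)^{(∑_i γ_i)(∑_i δ_i)} (a ·ₛ b)`. -/
theorem statement1 (R A : Type*) [CommRing R] [Ring A] [Algebra R A] (N : ℕ)
    (𝒜 : (Fin N → ZMod 2) → Submodule R A) [GradedAlgebra 𝒜]
    (hcomm : ∀ (γ δ : Fin N → ZMod 2) (a b : A), a ∈ 𝒜 γ → b ∈ 𝒜 δ →
      b * a = (-1 : A) ^ (∑ i : Fin N, (γ i).val * (δ i).val) * (a * b))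
    (mul' : A →ₗ[R] A →ₗ[R] A)
    (hmul : ∀ (γ δ : Fin N → ZMod 2) (a b : A), a ∈ 𝒜 γ → b ∈ 𝒜 δ →
      mul' a b =
        (-1 : A) ^ (∑ i : Fin N, ∑ j : Fin N,
          if j < i then (γ i).val * (δ j).val else 0) * (a * b)) :
    ∀ (γ δ : Fin N → ZMod 2) (a b : A), a ∈ 𝒜 γ → b ∈ 𝒜 δ →
      mul' b a =
        (-1 : A) ^ ((∑ i : Fin N, (γ i).val) * (∑ i : Fin N, (δ i).val)) * mul' a b := by
  intro γ δ a b ha hb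
  rw [hmul δ γ b a hb ha, hmul γ δ a b ha hb, hcomm γ δ a b ha hb,
    Finset.sum_mul_sum_eq_diag_add_triangular (fun i => (γ i).val) fun i => (δ i).val]
  simp only [← mul_assoc, ← pow_add]
  congr 2
  rw [neg_one_pow_eq_pow_mod_two, neg_one_pow_eq_pow_mod_two (n := _ + _ + _ + _)]
  congr 1
  lia
end

section
/- Let A be a commutative ℝ-algebra, m ≥ 0, x₀ ∈ ℝ^m, and let n_1, …, n_m ∈ A be nilpotent elements. Choose N such that n_1^{ν_1}⋯n_m^{ν_m} = 0 whenever ν_1 + … + ν_m ≥ N (such N exists since the n_i are nilpotent and commute). Then the Grassmann analytic continuation map z : C^∞(ℝ^m, ℝ) → A defined by z(f) := Σ_{|ν| < N} (1/ν!) (∂^ν f)(x₀) · n_1^{ν_1}⋯n_m^{ν_m} (sum over multi-indices ν with |ν| = ν_1+…+ν_m < N, ν! = ν_1!⋯ν_m!) is a homomorphism of ℝ-algebras, and it is independent of the choice of such N. -/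
/-- The partial derivative `∂_i f` of `f : ℝ^m → ℝ` in the `i`-th coordinate
direction. -/
noncomputable def pderiv' (m : ℕ) (i : Fin m) (f : (Fin m → ℝ) → ℝ) :
    (Fin m → ℝ) → ℝ :=
  fun x => fderiv ℝ f x (Pi.single i 1)

/-- The iterated partial derivative `∂^ν f = ∂_1^{ν_1} ⋯ ∂_m^{ν_m} f` for a
multi-index `ν`. -/
noncomputable def multiPDeriv (m : ℕ) (ν : Fin m → ℕ) (f : (Fin m → ℝ) → ℝ) :
    (Fin m → ℝ) → ℝ :=
  (List.finRange m).foldr (fun i g => (pderiv' m i)^[ν i] g) f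

/-- The Grassmann analytic continuation
`z(f) = ∑_{|ν| < N} (1/ν!) (∂^ν f)(x₀) · n₁^{ν_1} ⋯ n_m^{ν_m}`. -/
noncomputable def grassmannCont (A : Type*) [CommRing A] [Algebra ℝ A] (m : ℕ)
    (x₀ : Fin m → ℝ) (n : Fin m → A) (N : ℕ) (f : (Fin m → ℝ) → ℝ) : A :=
  ∑ ν ∈ (Fintype.piFinset fun _ : Fin m => Finset.range N).filter
      (fun ν => ∑ i, ν i < N),
    ((∏ i, ((ν i).factorial : ℝ))⁻¹ * multiPDeriv m ν f x₀) • ∏ i, n i ^ ν i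

open Finset in
/-- A product of two finite sums whose terms of total degree at least `K` vanish is the sum of
the Cauchy products of degree less than `K`. -/
lemma sum_range_mul_sum_range_eq_sum_antidiagonal {R : Type*} [NonUnitalNonAssocSemiring R]
    (K : ℕ) (u v : ℕ → R) (h : ∀ i j, K ≤ i + j → u i * v j = 0) :
    (∑ i ∈ range K, u i) * ∑ j ∈ range K, v j =
      ∑ k ∈ range K, ∑ p ∈ antidiagonal k, u p.1 * v p.2 := by
  rw [sum_mul_sum, ← sum_product', sum_sigma',
    ← sum_filter_of_ne (p := fun p : ℕ × ℕ => p.1 + p.2 < K)]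
  · refine sum_bij' (fun p _ => ⟨p.1 + p.2, p⟩) (fun q _ => q.2) ?_ ?_ ?_ ?_ ?_
    · simp
    · rintro ⟨k, i, j⟩ hq
      simp only [mem_sigma, mem_range, HasAntidiagonal.mem_antidiagonal, mem_filter,
        mem_product] at hq ⊢
      omega
    · simp
    · rintro ⟨k, i, j⟩ hq
      simp only [mem_sigma, HasAntidiagonal.mem_antidiagonal] at hq
      simp [hq.2]
    · simp
  · intro p _ hp
    by_contra hlt
    exact hp (h _ _ (not_lt.mp hlt))

namespace Derivation

variable {C : Type*} [CommRing C] [Algebra ℝ C]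

open Finset in
/-- The general Leibniz rule for iterates of a derivation. -/
lemma iterate_mul (D : Derivation ℝ C C) (k : ℕ) (f g : C) :
    D^[k] (f * g) =
      ∑ p ∈ antidiagonal k, k.choose p.1 • (D^[p.1] f * D^[p.2] g) := by
  induction k with
  | zero => simp
  | succ k ih =>
    rw [sum_antidiagonal_choose_succ_nsmul (fun i j => D^[i] f * D^[j] g),
      Function.iterate_succ_apply', ih, map_sum, ← sum_add_distrib]
    refine sum_congr rfl fun p hp => ?_
    rw [Nat.choose_symm_of_eq_add (HasAntidiagonal.mem_antidiagonal.mp hp).symm, ← smul_add,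
      map_nsmul, leibniz, Function.iterate_succ_apply', Function.iterate_succ_apply']
    simp only [smul_eq_mul]
    ring

variable {A : Type*} [CommRing A] [Algebra ℝ A]

open Finset in
/-- For a derivation `D` of `C`, an algebra homomorphism `e : C → A` and `a ∈ A` with
`a ^ K = 0`, the homomorphism `f ↦ ∑_{k < K} (1/k!) e(D^k f) a^k`, that is, `e ∘ exp(aD)`. -/
noncomputable def taylorHom (D : Derivation ℝ C C) (e : C →ₐ[ℝ] A) (a : A) (K : ℕ)
    (ha : a ^ K = 0) : C →ₐ[ℝ] A :=
  AlgHom.ofLinearMap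
    (∑ k ∈ range K, ((k.factorial : ℝ)⁻¹ • (LinearMap.mulRight ℝ (a ^ k) ∘ₗ e.toLinearMap ∘ₗ
      ((D : C →ₗ[ℝ] C) ^ k))))
    (by
      rcases K with _ | K
      · have := subsingleton_of_zero_eq_one (by simpa using ha.symm : (0 : A) = 1)
        exact Subsingleton.elim _ _
      · rw [sum_range_succ']
        simp [Module.End.coe_pow, iterate_map_zero])
    (by
      intro f g
      simp only [LinearMap.coe_sum, Finset.sum_apply, LinearMap.smul_apply, LinearMap.comp_apply,
        LinearMap.mulRight_apply, AlgHom.toLinearMap_apply, Module.End.coe_pow, coeFn_coe]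
      rw [sum_range_mul_sum_range_eq_sum_antidiagonal]
      · refine sum_congr rfl fun k _ => ?_
        rw [iterate_mul, map_sum, sum_mul, smul_sum]
        refine sum_congr rfl fun p hp => ?_
        have hk : p.1 + p.2 = k := HasAntidiagonal.mem_antidiagonal.mp hp
        have hc : (k.factorial : ℝ)⁻¹ * k.choose p.1 =
            (p.1.factorial : ℝ)⁻¹ * (p.2.factorial : ℝ)⁻¹ := by
          rw [← hk, Nat.cast_add_choose]
          have := Nat.factorial_ne_zero (p.1 + p.2)
          field_simp
        rw [map_nsmul, smul_mul_smul_comm, ← hc, smul_mul_assoc, ← Nat.cast_smul_eq_nsmul ℝ,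
          smul_smul, map_mul, ← hk, pow_add]
        congr 1
        ring
      · intro i j hij
        rw [smul_mul_smul_comm, mul_mul_mul_comm, ← pow_add, pow_eq_zero_of_le hij ha]
        simp)

lemma taylorHom_apply (D : Derivation ℝ C C) (e : C →ₐ[ℝ] A) (a : A) (K : ℕ)
    (ha : a ^ K = 0) (f : C) :
    taylorHom D e a K ha f =
      ∑ k ∈ Finset.range K, (k.factorial : ℝ)⁻¹ • (e (D^[k] f) * a ^ k) := by
  simp [taylorHom, Module.End.coe_pow]

open Finset in
/-- The truncated multivariate Taylor sum of finitely many derivations along elements of `A` whose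
`K`-th powers vanish is an algebra homomorphism. -/
lemma exists_algHom_eq_sum_piFinset {m : ℕ} (D : Fin m → Derivation ℝ C C) (e : C →ₐ[ℝ] A)
    (n : Fin m → A) (K : ℕ) (hn : ∀ i, n i ^ K = 0) :
    ∃ z : C →ₐ[ℝ] A, ∀ f, z f = ∑ ν ∈ Fintype.piFinset fun _ : Fin m => range K,
      (∏ i, ((ν i).factorial : ℝ))⁻¹ •
        (e ((List.finRange m).foldr (fun i g => (D i)^[ν i] g) f) * ∏ i, n i ^ ν i) := by
  induction m generalizing e with
  | zero => exact ⟨e, fun f => by simp⟩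
  | succ m ih =>
    obtain ⟨z, hz⟩ := ih (fun i => D i.succ) (taylorHom (D 0) e (n 0) K (hn 0))
      (fun i => n i.succ) fun i => hn i.succ
    refine ⟨z, fun f => ?_⟩
    have hbox := Finset.filter_piFinset_eq_map_consEquiv
      (fun _ : Fin (m + 1) => range K) (fun _ => True)
    simp only [filter_true] at hbox
    rw [hz, hbox, sum_map, sum_product_right]
    refine sum_congr rfl fun ν _ => ?_
    rw [taylorHom_apply, sum_mul, smul_sum]
    refine sum_congr rfl fun k _ => ?_
    simp only [Equiv.coe_toEmbedding, Fin.consEquiv_apply, Fin.prod_univ_succ, Fin.cons_zero,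
      Fin.cons_succ, List.finRange_succ, List.foldr_cons, List.foldr_map]
    rw [smul_mul_assoc, smul_smul, mul_inv, mul_comm (_⁻¹ : ℝ), mul_assoc]

end Derivation

/-- The algebra of smooth real-valued functions on `ℝ^m`. -/
def smoothSubalgebra (m : ℕ) : Subalgebra ℝ ((Fin m → ℝ) → ℝ) where
  carrier := {f | ContDiff ℝ (⊤ : ℕ∞) f}
  mul_mem' hf hg := ContDiff.mul (𝕜 := ℝ) (n := (⊤ : ℕ∞)) hf hg
  add_mem' hf hg := ContDiff.add (𝕜 := ℝ) (n := (⊤ : ℕ∞)) hf hg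
  algebraMap_mem' c := (contDiff_const : ContDiff ℝ (⊤ : ℕ∞) fun _ : Fin m → ℝ => c)

lemma ContDiff.pderiv' {m : ℕ} (i : Fin m) {f : (Fin m → ℝ) → ℝ}
    (hf : ContDiff ℝ (⊤ : ℕ∞) f) : ContDiff ℝ (⊤ : ℕ∞) (pderiv' m i f) :=
  (hf.fderiv_right (m := (⊤ : ℕ∞)) (by simp)).clm_apply contDiff_const

/-- The partial derivative in the `i`-th coordinate direction as a derivation of the algebra of
smooth functions. -/
noncomputable def smoothPDeriv (m : ℕ) (i : Fin m) :
    Derivation ℝ (smoothSubalgebra m) (smoothSubalgebra m) :=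
  have hdiff (f : smoothSubalgebra m) : Differentiable ℝ f.1 :=
    ContDiff.differentiable (n := (⊤ : ℕ∞)) f.2 (by simp)
  Derivation.mk'
    { toFun := fun f => ⟨pderiv' m i f, ContDiff.pderiv' i f.2⟩
      map_add' := fun f g => by
        ext x
        simp [pderiv', fderiv_add (hdiff f x) (hdiff g x)]
      map_smul' := fun c f => by
        ext x
        simp [pderiv', fderiv_const_smul (hdiff f x) c] }
    fun f g => by
      ext x
      simp [pderiv', fderiv_mul (hdiff f x) (hdiff g x)]

lemma coe_iterate_smoothPDeriv {m : ℕ} (i : Fin m) (k : ℕ) (f : smoothSubalgebra m) :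
    (((smoothPDeriv m i)^[k] f : smoothSubalgebra m) : (Fin m → ℝ) → ℝ) =
      (pderiv' m i)^[k] f :=
  Function.Semiconj.iterate_right (f := Subtype.val) (fun _ => rfl) k f

lemma coe_foldr_smoothPDeriv {m : ℕ} (ν : Fin m → ℕ) (l : List (Fin m))
    (f : smoothSubalgebra m) :
    ((l.foldr (fun i g => (smoothPDeriv m i)^[ν i] g) f : smoothSubalgebra m) :
      (Fin m → ℝ) → ℝ) = l.foldr (fun i g => (pderiv' m i)^[ν i] g) f := by
  induction l with
  | nil => rfl
  | cons i l ih => rw [List.foldr_cons, List.foldr_cons, coe_iterate_smoothPDeriv, ih]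

/-- Evaluation of smooth functions at `x₀`, with values in an `ℝ`-algebra. -/
noncomputable def smoothEval (A : Type*) [CommRing A] [Algebra ℝ A] {m : ℕ} (x₀ : Fin m → ℝ) :
    smoothSubalgebra m →ₐ[ℝ] A :=
  (Algebra.ofId ℝ A).comp
    ((Pi.evalAlgHom ℝ (fun _ : Fin m → ℝ => ℝ) x₀).comp (smoothSubalgebra m).val)

open Finset in
/-- The truncation of the Grassmann analytic continuation by total degree may be replaced by any
larger truncation by partial degrees. -/
lemma grassmannCont_eq_sum_piFinset (A : Type*) [CommRing A] [Algebra ℝ A] {m : ℕ}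
    (x₀ : Fin m → ℝ) (n : Fin m → A) {N M : ℕ}
    (hN : ∀ ν : Fin m → ℕ, N ≤ ∑ i, ν i → ∏ i, n i ^ ν i = 0) (hNM : N ≤ M)
    (f : (Fin m → ℝ) → ℝ) :
    grassmannCont A m x₀ n N f = ∑ ν ∈ Fintype.piFinset fun _ : Fin m => range M,
      ((∏ i, ((ν i).factorial : ℝ))⁻¹ * multiPDeriv m ν f x₀) • ∏ i, n i ^ ν i := by
  refine sum_subset (fun ν hν => ?_) fun ν hν hν' => ?_
  · simp only [mem_filter, Fintype.mem_piFinset, mem_range] at hν ⊢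
    exact fun i => (hν.1 i).trans_le hNM
  · rw [hN ν, smul_zero]
    by_contra! hlt
    refine hν' (mem_filter.mpr ⟨Fintype.mem_piFinset.mpr fun i => mem_range.mpr ?_, hlt⟩)
    exact (single_le_sum (fun _ _ => Nat.zero_le _) (mem_univ i)).trans_lt hlt

/-- The Grassmann analytic continuation is the restriction of an algebra homomorphism on smooth
functions. -/
lemma exists_algHom_eq_grassmannCont (A : Type*) [CommRing A] [Algebra ℝ A] {m : ℕ}
    (x₀ : Fin m → ℝ) (n : Fin m → A) {N : ℕ}
    (hN : ∀ ν : Fin m → ℕ, N ≤ ∑ i, ν i → ∏ i, n i ^ ν i = 0) :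
    ∃ z : smoothSubalgebra m →ₐ[ℝ] A, ∀ f, z f = grassmannCont A m x₀ n N f := by
  have hpow (i : Fin m) : n i ^ N = 0 := by
    have h := hN (Pi.single i N) (by simp)
    rwa [Fintype.prod_eq_single i fun j hj => by simp [hj], Pi.single_eq_same] at h
  obtain ⟨z, hz⟩ := Derivation.exists_algHom_eq_sum_piFinset (smoothPDeriv m)
    (smoothEval A x₀) n N hpow
  refine ⟨z, fun f => ?_⟩
  rw [hz, grassmannCont_eq_sum_piFinset A x₀ n hN le_rfl]
  refine Finset.sum_congr rfl fun ν _ => ?_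
  have heval : smoothEval A x₀
      ((List.finRange m).foldr (fun i g => (smoothPDeriv m i)^[ν i] g) f) =
        algebraMap ℝ A (multiPDeriv m ν f x₀) := by
    rw [multiPDeriv, ← coe_foldr_smoothPDeriv]
    rfl
  rw [heval, ← Algebra.smul_def, smul_smul]

/-- Let `A` be a commutative `ℝ`-algebra, `x₀ ∈ ℝ^m`, and
`n_1, …, n_m ∈ A` nilpotent elements; let `N` be such that
`n_1^{ν_1} ⋯ n_m^{ν_m} = 0` whenever `ν_1 + … + ν_m ≥ N`.  Then the Grassmann
analytic continuation `z : C^∞(ℝ^m, ℝ) → A` is a homomorphism of `ℝ`-algebras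
(it preserves `1`, sums, products and real scalar multiples of smooth functions),
and it does not depend on the choice of such an `N`. -/
theorem statement7 (A : Type*) [CommRing A] [Algebra ℝ A] (m : ℕ) (x₀ : Fin m → ℝ)
    (n : Fin m → A) (hnil : ∀ i, IsNilpotent (n i)) (N : ℕ)
    (hN : ∀ ν : Fin m → ℕ, N ≤ ∑ i, ν i → ∏ i, n i ^ ν i = 0) :
    (grassmannCont A m x₀ n N (fun _ => 1) = 1) ∧
    (∀ f g : (Fin m → ℝ) → ℝ, ContDiff ℝ (⊤ : ℕ∞) f → ContDiff ℝ (⊤ : ℕ∞) g →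
      grassmannCont A m x₀ n N (f + g) =
        grassmannCont A m x₀ n N f + grassmannCont A m x₀ n N g) ∧
    (∀ f g : (Fin m → ℝ) → ℝ, ContDiff ℝ (⊤ : ℕ∞) f → ContDiff ℝ (⊤ : ℕ∞) g →
      grassmannCont A m x₀ n N (f * g) =
        grassmannCont A m x₀ n N f * grassmannCont A m x₀ n N g) ∧
    (∀ (c : ℝ) (f : (Fin m → ℝ) → ℝ), ContDiff ℝ (⊤ : ℕ∞) f →
      grassmannCont A m x₀ n N (c • f) = c • grassmannCont A m x₀ n N f) ∧
    (∀ N' : ℕ, (∀ ν : Fin m → ℕ, N' ≤ ∑ i, ν i → ∏ i, n i ^ ν i = 0) →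
      ∀ f : (Fin m → ℝ) → ℝ, ContDiff ℝ (⊤ : ℕ∞) f →
        grassmannCont A m x₀ n N f = grassmannCont A m x₀ n N' f) := by
  obtain ⟨z, hz⟩ := exists_algHom_eq_grassmannCont A x₀ n hN
  refine ⟨?_, fun f g hf hg => ?_, fun f g hf hg => ?_, fun c f hf => ?_, fun N' hN' f _ => ?_⟩
  · exact (hz 1).symm.trans (map_one z)
  · have h := map_add z ⟨f, hf⟩ ⟨g, hg⟩
    rwa [hz, hz, hz] at h
  · have h := map_mul z ⟨f, hf⟩ ⟨g, hg⟩
    rwa [hz, hz, hz] at h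
  · have h := map_smul z c ⟨f, hf⟩
    rwa [hz, hz] at h
  · rw [grassmannCont_eq_sum_piFinset A x₀ n hN (le_max_left N N'),
      grassmannCont_eq_sum_piFinset A x₀ n hN' (le_max_right N N')]
end
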